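/- arXiv:1712.01142 — 2 statements merged into one kernel-verified Lean document; each statement's English description precedes it below -/
import Mathlib

section
/- Let D ⊆ ℝⁿ be a convex set, let F : ℝⁿ → ℝⁿ be continuously differentiable with ‖F′(x) − F′(y)‖ ≤ L‖x − y‖ for all x, y ∈ D, let σ ∈ (0,1), and let x_{k−n}, x_{k−n+1}, …, x_{k+1} ∈ D. Suppose that for indices μ_1, ν_1, …, μ_ℓ, ν_ℓ all lying in {k−n+1, …, k+1} (1 ≤ ℓ ≤ n), the vectors Δx_j = x_{μ_j} − x_{ν_j} are nonzero and σ-safely linearly independent, and the n×n matrix A_{k+1} satisfies A_{k+1} Δx_j = F(x_{μ_j}) − F(x_{ν_j}) for all j and A_{k+1} v = F′(x_{k+1}) v for every v orthogonal to span{Δx_1, …, Δx_ℓ}. Then ‖A_{k+1} − F′(x_{k+1})‖ ≤ (L√n/σ) ∑_{i=k−n+1}^{k} ‖x_{i+1} − x_i‖. -/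
open Matrix

/-- Nonzero vectors `v 1, …, v m` in `ℝⁿ` are `σ`-safely linearly independent if
`det (VᵀV) ≥ σ²`, where the `j`-th column of `V` is `v j / ‖v j‖`. -/
def safelyLinIndep {ι : Type} [Fintype ι] [DecidableEq ι] {n : ℕ} (σ : ℝ)
    (v : ι → EuclideanSpace ℝ (Fin n)) : Prop :=
  (∀ j, v j ≠ 0) ∧
    σ ^ 2 ≤ ((Matrix.of fun i (j : ι) => v j i / ‖v j‖)ᵀ *
      (Matrix.of fun i (j : ι) => v j i / ‖v j‖)).det

theorem le_of_sq_le_sq_aux {a b : ℝ} (h : a ^ 2 ≤ b ^ 2) (hb : 0 ≤ b) : a ≤ b :=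
  (le_abs_self a).trans (abs_le_of_sq_le_sq h hb)

theorem aux_gram {ℓ n : ℕ} (hℓ : 0 < ℓ) (σ : ℝ) (hσ : 0 < σ)
    (u : Fin ℓ → EuclideanSpace ℝ (Fin n)) (hu : ∀ j, ‖u j‖ = 1)
    (hdet : σ ^ 2 ≤ ((Matrix.of fun i (j : Fin ℓ) => u j i)ᵀ *
      (Matrix.of fun i (j : Fin ℓ) => u j i)).det) :
    ∃ lam : ℝ, 0 < lam ∧ (ℓ = 1 → lam = 1) ∧ σ ^ 2 ≤ lam * Real.exp (1 - lam) ∧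
      ∀ c : Fin ℓ → ℝ, lam * ∑ j, c j ^ 2 ≤ ‖∑ j, c j • u j‖ ^ 2 := by
  set G : Matrix (Fin ℓ) (Fin ℓ) ℝ := (Matrix.of fun i (j : Fin ℓ) => u j i)ᵀ *
      (Matrix.of fun i (j : Fin ℓ) => u j i) with hG
  have hGe : ∀ i j, G i j = inner ℝ (u i) (u j) := by
    intro i j
    simp [hG, Matrix.mul_apply, PiLp.inner_apply, mul_comm]
  have hPSD : G.PosSemidef := by
    have := Matrix.posSemidef_conjTranspose_mul_self (Matrix.of fun i (j : Fin ℓ) => u j i)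
    rwa [Matrix.conjTranspose_eq_transpose_of_trivial] at this
  have hH := hPSD.isHermitian
  have : Nonempty (Fin ℓ) := ⟨⟨0, hℓ⟩⟩
  obtain ⟨i0, hi0⟩ := Finite.exists_min hH.eigenvalues
  have hnn : ∀ i, 0 ≤ hH.eigenvalues i := hPSD.eigenvalues_nonneg
  have hd : G.det = ∏ i, hH.eigenvalues i := by simpa using hH.det_eq_prod_eigenvalues
  have htr : ∑ i, hH.eigenvalues i = ℓ := by
    have h1 : G.trace = ∑ i, hH.eigenvalues i := by simpa using hH.trace_eq_sum_eigenvalues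
    rw [← h1]
    simp [Matrix.trace, hGe, hu]
  have hbound : G.det ≤ hH.eigenvalues i0 * Real.exp (1 - hH.eigenvalues i0) := by
    rw [hd, ← Finset.mul_prod_erase _ _ (Finset.mem_univ i0)]
    apply mul_le_mul_of_nonneg_left _ (hnn i0)
    have h2 : ∏ i ∈ Finset.univ.erase i0, hH.eigenvalues i ≤
        ∏ i ∈ Finset.univ.erase i0, Real.exp (hH.eigenvalues i - 1) := by
      apply Finset.prod_le_prod
      · intro i _; exact hnn i
      · intro i _
        have := Real.add_one_le_exp (hH.eigenvalues i - 1)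
        linarith
    refine h2.trans (le_of_eq ?_)
    rw [← Real.exp_sum]
    congr 1
    rw [← Finset.add_sum_erase _ _ (Finset.mem_univ i0)] at htr
    rw [Finset.sum_sub_distrib]
    simp only [Finset.sum_const, Finset.card_erase_of_mem (Finset.mem_univ i0), Finset.card_univ,
      Fintype.card_fin, nsmul_eq_mul, mul_one]
    rw [Nat.cast_sub hℓ]
    push_cast
    linarith
  refine ⟨hH.eigenvalues i0, ?_, ?_, hdet.trans hbound, ?_⟩
  · rcases (hnn i0).lt_or_eq with h | h
    · exact h
    · exfalso
      rw [← h] at hbound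
      have : 0 < σ ^ 2 := by positivity
      linarith
  · intro h1
    subst h1
    rw [Fin.sum_univ_one] at htr
    rw [Subsingleton.elim i0 0, htr]; simp
  · intro c
    set b := hH.eigenvectorBasis with hb
    set w : EuclideanSpace ℝ (Fin ℓ) := WithLp.toLp 2 c with hw
    have hsym := isSymmetric_toEuclideanLin_iff.mpr hH
    have hTb : ∀ i, Matrix.toEuclideanLin G (b i) = hH.eigenvalues i • b i := by
      intro i
      ext j
      have := congrFun (hH.mulVec_eigenvectorBasis i) j
      simpa [Matrix.toLpLin_apply] using this
    have h1 : ‖∑ j, c j • u j‖ ^ 2 = inner ℝ w (Matrix.toEuclideanLin G w) := by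
      rw [← real_inner_self_eq_norm_sq, sum_inner]
      simp only [PiLp.inner_apply, Matrix.toLpLin_apply, inner_sum, inner_smul_left,
        inner_smul_right, hw, Matrix.mulVec, dotProduct, hGe]
      apply Finset.sum_congr rfl
      intro i _
      simp [Finset.mul_sum, Finset.sum_mul]
      apply Finset.sum_congr rfl
      intro j _
      ring
    have h2 : ∑ j, c j ^ 2 = ∑ i, (inner ℝ (b i) w) ^ 2 := by
      have e1 : ∑ j, c j ^ 2 = ‖w‖ ^ 2 := by
        rw [EuclideanSpace.norm_sq_eq]; simp [hw]
      rw [e1, ← real_inner_self_eq_norm_sq, ← b.sum_inner_mul_inner]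
      apply Finset.sum_congr rfl
      intro i _
      rw [real_inner_comm w (b i)]; ring
    rw [h1, h2, ← b.sum_inner_mul_inner, Finset.mul_sum]
    apply Finset.sum_le_sum
    intro i _
    rw [← hsym (b i) w, hTb, inner_smul_left, real_inner_comm w (b i)]
    have := hi0 i
    simp only [conj_trivial]
    nlinarith [sq_nonneg (inner ℝ (b i) w : ℝ)]

theorem aux_ineq (ℓ : ℕ) (hℓ : 0 < ℓ) (σ lam : ℝ) (hσ : 0 < σ) (hlam : 0 < lam)
    (h1 : ℓ = 1 → lam = 1) (h : σ ^ 2 ≤ lam * Real.exp (1 - lam)) :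
    1 + Real.sqrt ℓ / Real.sqrt lam ≤ 2 * (Real.sqrt ℓ / σ) := by
  set q := Real.exp ((1 - lam) / 2) with hq
  have hqpos : 0 < q := Real.exp_pos _
  have hqq : Real.exp (1 - lam) = q ^ 2 := by
    rw [hq, ← Real.exp_nat_mul]; congr 1; push_cast; ring
  set r := Real.sqrt lam with hr
  have hrpos : 0 < r := Real.sqrt_pos.mpr hlam
  have hrr : lam = r ^ 2 := (Real.sq_sqrt hlam.le).symm
  set m := Real.sqrt ℓ with hm
  have hℓ' : (0:ℝ) < ℓ := by exact_mod_cast hℓ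
  have hmpos : 0 < m := Real.sqrt_pos.mpr hℓ'
  have hmm : m ^ 2 = ℓ := Real.sq_sqrt hℓ'.le
  have hσle : σ ≤ r * q := by
    apply le_of_sq_le_sq_aux _ (by positivity)
    rw [mul_pow, ← hrr, ← hqq]; exact h
  -- key inequality
  have key : q * (r + m) ≤ 2 * m := by
    rcases Nat.lt_or_ge ℓ 2 with h2 | h2
    · have : ℓ = 1 := by omega
      have hl := h1 this
      have hq1 : q = 1 := by rw [hq, hl]; simp
      have hr1 : r = 1 := by rw [hr, hl]; simp
      have hm1 : m = 1 := by rw [hm, this]; simp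
      rw [hq1, hr1, hm1]; norm_num
    · have h2' : (2:ℝ) ≤ ℓ := by exact_mod_cast h2
      set s := r / m with hs
      have hspos : 0 < s := by positivity
      have hrs : r = s * m := by rw [hs]; field_simp
      have hls : 2 * s ^ 2 ≤ lam := by
        rw [hrr, hrs, mul_pow, hmm]
        nlinarith [sq_nonneg s]
      -- bound q from above
      have hE : q * Real.exp (s ^ 2) ≤ Real.exp (1/2) := by
        rw [hq, ← Real.exp_add]
        apply Real.exp_le_exp.mpr
        linarith
      have hhalf : Real.exp (1/2) ≤ 1.6488 := by
        have e2 : Real.exp (1/2) ^ 2 = Real.exp 1 := by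
          rw [← Real.exp_nat_mul]; congr 1; norm_num
        have := Real.exp_one_lt_d9
        apply le_of_sq_le_sq_aux _ (by norm_num)
        rw [e2]; norm_num at this ⊢; linarith
      have hq4 := Real.quadratic_le_exp_of_nonneg (sq_nonneg s)
      have hpoly : 1.6488 * (1 + s) ≤ 2 * (1 + s ^ 2 + (s ^ 2) ^ 2 / 2) := by
        nlinarith [sq_nonneg (s ^ 2 - 0.13), sq_nonneg (s - 0.365)]
      have hfin : q * (1 + s) ≤ 2 := by
        have hep := Real.exp_pos (s ^ 2)
        have : q * (1 + s) * Real.exp (s ^ 2) ≤ 2 * Real.exp (s ^ 2) := by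
          calc q * (1 + s) * Real.exp (s ^ 2) = (q * Real.exp (s ^ 2)) * (1 + s) := by ring
            _ ≤ 1.6488 * (1 + s) := by
                apply mul_le_mul_of_nonneg_right (hE.trans hhalf); positivity
            _ ≤ _ := hpoly.trans (by linarith)
        exact le_of_mul_le_mul_right this hep
      rw [hrs]
      nlinarith
  have : 1 + m / r = (r + m) / r := by field_simp
  rw [this]
  have e : 2 * (m / σ) = 2 * m / σ := by ring
  rw [e, div_le_div_iff₀ hrpos hσ]
  calc (r + m) * σ ≤ (r + m) * (r * q) := by gcongr
    _ = q * (r + m) * r := by ring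
    _ ≤ 2 * m * r := by gcongr

theorem le_path_sum {n : ℕ} (x : ℕ → EuclideanSpace ℝ (Fin n)) (a b i : ℕ) (hab : a ≤ b + 1)
    (hi : i ∈ Finset.Icc a (b + 1)) :
    ‖x i - x a‖ + ‖x i - x (b + 1)‖ ≤ ∑ i ∈ Finset.Icc a b, ‖x (i + 1) - x i‖ := by
  rw [Finset.mem_Icc] at hi
  have h1 := dist_le_Ico_sum_dist x hi.1
  have h2 := dist_le_Ico_sum_dist x hi.2
  have e : Finset.Icc a b = Finset.Ico a (b + 1) := by ext; simp
  rw [e, ← Finset.sum_Ico_consecutive _ hi.1 hi.2]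
  simp only [dist_eq_norm] at h1 h2
  rw [norm_sub_rev (x i) (x a)]
  refine (add_le_add h1 h2).trans (le_of_eq ?_)
  simp only [norm_sub_rev]

set_option maxHeartbeats 1000000 in
/-- **Lemma 4, bound (24).** If `A_{k+1}` is built from `σ`-safely linearly independent
difference vectors of the iterates `x_{k−n+1}, …, x_{k+1}` and agrees with `F′(x_{k+1})`
on the orthogonal complement of their span, then
`‖A_{k+1} − F′(x_{k+1})‖ ≤ (L√n/σ) ∑_{i=k−n+1}^{k} ‖x_{i+1} − x_i‖`. -/
theorem stmt_6 {n : ℕ} (D : Set (EuclideanSpace ℝ (Fin n))) (hD : Convex ℝ D)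
    (F : EuclideanSpace ℝ (Fin n) → EuclideanSpace ℝ (Fin n)) (hF : ContDiff ℝ 1 F)
    (L : ℝ)
    (hLip : ∀ x ∈ D, ∀ y ∈ D, ‖fderiv ℝ F x - fderiv ℝ F y‖ ≤ L * ‖x - y‖)
    (σ : ℝ) (hσ : σ ∈ Set.Ioo (0 : ℝ) 1)
    (k : ℕ) (hk : n ≤ k)
    (x : ℕ → EuclideanSpace ℝ (Fin n))
    (hxD : ∀ i ∈ Finset.Icc (k - n) (k + 1), x i ∈ D)
    (ℓ : ℕ) (hℓ : 0 < ℓ) (hℓn : ℓ ≤ n)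
    (μ ν : Fin ℓ → ℕ)
    (hμ : ∀ j, μ j ∈ Finset.Icc (k - n + 1) (k + 1))
    (hν : ∀ j, ν j ∈ Finset.Icc (k - n + 1) (k + 1))
    (hsli : safelyLinIndep σ (fun j => x (μ j) - x (ν j)))
    (A : Matrix (Fin n) (Fin n) ℝ)
    (hA1 : ∀ j, Matrix.toEuclideanLin A (x (μ j) - x (ν j)) = F (x (μ j)) - F (x (ν j)))
    (hA2 : ∀ v : EuclideanSpace ℝ (Fin n),
      (∀ j, inner ℝ (x (μ j) - x (ν j)) v = (0 : ℝ)) →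
      Matrix.toEuclideanLin A v = fderiv ℝ F (x (k + 1)) v) :
    ‖Matrix.toEuclideanCLM (𝕜 := ℝ) A - fderiv ℝ F (x (k + 1))‖ ≤
      L * Real.sqrt n / σ * ∑ i ∈ Finset.Icc (k - n + 1) k, ‖x (i + 1) - x i‖ := by
  obtain ⟨hne, hdet⟩ := hsli
  obtain ⟨hσ0, hσ1⟩ := hσ
  set S := ∑ i ∈ Finset.Icc (k - n + 1) k, ‖x (i + 1) - x i‖ with hS
  have hS0 : 0 ≤ S := Finset.sum_nonneg fun _ _ => norm_nonneg _
  have hpath : ∀ i ∈ Finset.Icc (k - n + 1) (k + 1),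
      ‖x i - x (k - n + 1)‖ + ‖x i - x (k + 1)‖ ≤ S := fun i hi =>
    le_path_sum x (k - n + 1) k i (by omega) hi
  have hxD' : ∀ i ∈ Finset.Icc (k - n + 1) (k + 1), x i ∈ D := by
    intro i hi
    apply hxD
    rw [Finset.mem_Icc] at hi ⊢
    omega
  have hfirst : k - n + 1 ∈ Finset.Icc (k - n + 1) (k + 1) := by
    rw [Finset.mem_Icc]; omega
  have hlast : k + 1 ∈ Finset.Icc (k - n + 1) (k + 1) := by
    rw [Finset.mem_Icc]; omega
  -- nonnegativity of `L`
  have hL : 0 ≤ L := by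
    have h1 := hLip _ (hxD' _ (hμ ⟨0, hℓ⟩)) _ (hxD' _ (hν ⟨0, hℓ⟩))
    have h2 : 0 < ‖x (μ ⟨0, hℓ⟩) - x (ν ⟨0, hℓ⟩)‖ := norm_pos_iff.mpr (hne ⟨0, hℓ⟩)
    by_contra hneg
    push Not at hneg
    have := norm_nonneg (fderiv ℝ F (x (μ ⟨0, hℓ⟩)) - fderiv ℝ F (x (ν ⟨0, hℓ⟩)))
    nlinarith
  -- the midpoint
  set y := midpoint ℝ (x (k - n + 1)) (x (k + 1)) with hy
  have hyD : y ∈ D := hD.midpoint_mem (hxD' _ hfirst) (hxD' _ hlast)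
  have hdist : ∀ i ∈ Finset.Icc (k - n + 1) (k + 1), ‖x i - y‖ ≤ S / 2 := by
    intro i hi
    have e : x i - y = (1 / 2 : ℝ) • ((x i - x (k - n + 1)) + (x i - x (k + 1))) := by
      rw [hy, midpoint_eq_smul_add]
      simp only [invOf_eq_inv]
      module
    rw [e, norm_smul]
    have h1 := norm_add_le (x i - x (k - n + 1)) (x i - x (k + 1))
    have h2 := hpath i hi
    norm_num
    linarith
  set B := fderiv ℝ F y with hB
  set T := Matrix.toEuclideanCLM (𝕜 := ℝ) A with hT
  have hTA : ∀ v, T v = Matrix.toEuclideanLin A v := fun v => rfl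
  have hTv : ∀ j, ‖(T - B) (x (μ j) - x (ν j))‖ ≤ L * (S / 2) * ‖x (μ j) - x (ν j)‖ := by
    intro j
    have hmv := Convex.norm_image_sub_le_of_norm_fderiv_le' (𝕜 := ℝ) (f := F) (φ := B)
      (s := D ∩ Metric.closedBall y (S / 2)) (C := L * (S / 2)) (x := x (ν j)) (y := x (μ j))
      (fun z _ => (hF.differentiable (by norm_num)) z)
      (fun z hz => (hLip z hz.1 y hyD).trans (by
        have := hz.2
        rw [Metric.mem_closedBall, dist_eq_norm] at this
        gcongr))
      (hD.inter (convex_closedBall _ _))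
      ⟨hxD' _ (hν j), by rw [Metric.mem_closedBall, dist_eq_norm]; exact hdist _ (hν j)⟩
      ⟨hxD' _ (hμ j), by rw [Metric.mem_closedBall, dist_eq_norm]; exact hdist _ (hμ j)⟩
    rw [_root_.sub_apply, hTA, hA1]
    exact hmv
  -- normalized vectors
  set u : Fin ℓ → EuclideanSpace ℝ (Fin n) :=
    fun j => ‖x (μ j) - x (ν j)‖⁻¹ • (x (μ j) - x (ν j)) with hu
  have hpos : ∀ j, 0 < ‖x (μ j) - x (ν j)‖ := fun j => norm_pos_iff.mpr (hne j)
  have hu1 : ∀ j, ‖u j‖ = 1 := by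
    intro j
    rw [hu]
    simp only [norm_smul, norm_inv, norm_norm]
    exact inv_mul_cancel₀ (hpos j).ne'
  have hTu : ∀ j, ‖(T - B) (u j)‖ ≤ L * (S / 2) := by
    intro j
    rw [hu]
    simp only [map_smul, norm_smul, norm_inv, norm_norm]
    rw [inv_mul_le_iff₀ (hpos j)]
    linarith [hTv j]
  have hmat : (Matrix.of fun i (j : Fin ℓ) => u j i) =
      (Matrix.of fun i (j : Fin ℓ) => (x (μ j) - x (ν j)) i / ‖x (μ j) - x (ν j)‖) := by
    ext i j
    simp only [hu, Matrix.of_apply, PiLp.smul_apply, smul_eq_mul]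
    rw [div_eq_inv_mul]
  obtain ⟨lam, hlam, hlam1, hlamσ, hquad⟩ := aux_gram hℓ σ hσ0 u hu1 (by rw [hmat]; exact hdet)
  have hineq := aux_ineq ℓ hℓ σ lam hσ0 hlam hlam1 hlamσ
  have hmono : Real.sqrt ℓ ≤ Real.sqrt n := Real.sqrt_le_sqrt (by exact_mod_cast hℓn)
  clear_value S u B T y
  have hLS : 0 ≤ L * (S / 2) := mul_nonneg hL (by linarith)
  have hfinal : L * (S / 2) * (1 + Real.sqrt ℓ / Real.sqrt lam) ≤ L * Real.sqrt n / σ * S := by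
    calc L * (S / 2) * (1 + Real.sqrt ℓ / Real.sqrt lam)
        ≤ L * (S / 2) * (2 * (Real.sqrt n / σ)) := by
          apply mul_le_mul_of_nonneg_left _ (by positivity)
          refine hineq.trans ?_
          gcongr
      _ = _ := by ring
  refine le_trans ?_ hfinal
  apply ContinuousLinearMap.opNorm_le_bound _ (by positivity)
  intro w
  -- decompose `w`
  set K := Submodule.span ℝ (Set.range u) with hK
  obtain ⟨w1, hw1, w2, hw2, hw⟩ := K.exists_add_mem_mem_orthogonal w
  have hw2z : (T - fderiv ℝ F (x (k + 1))) w2 = 0 := by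
    rw [_root_.sub_apply, hTA, hA2 w2, sub_self]
    intro j
    have h1 : x (μ j) - x (ν j) = ‖x (μ j) - x (ν j)‖ • u j := by
      rw [hu]
      simp only [smul_smul]
      rw [mul_inv_cancel₀ (hpos j).ne', one_smul]
    rw [h1, inner_smul_left, (Submodule.mem_orthogonal K w2).mp hw2 (u j)
      (Submodule.subset_span ⟨j, rfl⟩), mul_zero]
  have hnorm : ‖w1‖ ≤ ‖w‖ := by
    have h0 : inner ℝ w1 w2 = (0 : ℝ) := (Submodule.mem_orthogonal K w2).mp hw2 w1 hw1
    have := norm_add_sq_eq_norm_sq_add_norm_sq_of_inner_eq_zero w1 w2 h0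
    rw [← hw] at this
    apply le_of_sq_le_sq_aux _ (norm_nonneg _)
    nlinarith [mul_self_nonneg ‖w2‖]
  obtain ⟨c, hc⟩ := (Submodule.mem_span_range_iff_exists_fun ℝ).mp hw1
  have hcsum : ∑ j, |c j| ≤ Real.sqrt ℓ / Real.sqrt lam * ‖w1‖ := by
    have hq := hquad c
    rw [hc] at hq
    have hcs := sq_sum_le_card_mul_sum_sq (s := Finset.univ) (f := fun j => |c j|)
    simp only [sq_abs, Finset.card_univ, Fintype.card_fin] at hcs
    apply le_of_sq_le_sq_aux _ (by positivity)
    rw [mul_pow, div_pow, Real.sq_sqrt (by positivity), Real.sq_sqrt hlam.le]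
    refine hcs.trans ?_
    rw [div_mul_eq_mul_div, le_div_iff₀ hlam]
    have hl0 : (0 : ℝ) ≤ ℓ := by positivity
    nlinarith
  have hTw : ‖(T - B) w1‖ ≤ L * (S / 2) * (Real.sqrt ℓ / Real.sqrt lam * ‖w1‖) := by
    rw [← hc, map_sum]
    refine (norm_sum_le _ _).trans ?_
    rw [hc]
    calc ∑ j, ‖(T - B) (c j • u j)‖ ≤ ∑ j, L * (S / 2) * |c j| := by
          apply Finset.sum_le_sum
          intro j _
          rw [map_smul, norm_smul, Real.norm_eq_abs, mul_comm]
          exact mul_le_mul_of_nonneg_right (hTu j) (abs_nonneg _)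
      _ = L * (S / 2) * ∑ j, |c j| := by rw [Finset.mul_sum]
      _ ≤ _ := mul_le_mul_of_nonneg_left hcsum hLS
  have hBw : ‖(B - fderiv ℝ F (x (k + 1))) w1‖ ≤ L * (S / 2) * ‖w1‖ := by
    refine (ContinuousLinearMap.le_opNorm _ _).trans ?_
    apply mul_le_mul_of_nonneg_right _ (norm_nonneg _)
    rw [hB]
    refine (hLip y hyD _ (hxD' _ hlast)).trans ?_
    apply mul_le_mul_of_nonneg_left _ hL
    rw [norm_sub_rev]
    exact hdist _ hlast
  have hsplit : (T - fderiv ℝ F (x (k + 1))) w =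
      (T - B) w1 + (B - fderiv ℝ F (x (k + 1))) w1 := by
    rw [hw, map_add, hw2z, add_zero]
    simp only [_root_.sub_apply]
    abel
  rw [hsplit]
  refine (norm_add_le _ _).trans ?_
  calc _ ≤ L * (S / 2) * (Real.sqrt ℓ / Real.sqrt lam * ‖w1‖) + L * (S / 2) * ‖w1‖ :=
        add_le_add hTw hBw
    _ = L * (S / 2) * (1 + Real.sqrt ℓ / Real.sqrt lam) * ‖w1‖ := by ring
    _ ≤ _ := mul_le_mul_of_nonneg_left hnorm (mul_nonneg hLS (by positivity))
end

section
/- Let D ⊆ ℝⁿ be a convex set, let F : ℝⁿ → ℝⁿ be continuously differentiable with ‖F′(x) − F′(y)‖ ≤ L‖x − y‖ for all x, y ∈ D, let σ ∈ (0,1), and let x_{k−n}, x_{k−n+1}, …, x_{k+1} ∈ D. Suppose the n×n matrix A_{k+1} is built from difference vectors Δx_j = x_{μ_j} − x_{ν_j} with all indices μ_j, ν_j in {k−n+1, …, k+1} that are nonzero and σ-safely linearly independent, in the sense that A_{k+1} Δx_j = F(x_{μ_j}) − F(x_{ν_j}) for all j and A_{k+1} v = F′(x_{k+1}) v for every v orthogonal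 to the span of these Δx_j; and suppose the n×n matrix A_k is built in the same way from difference vectors x_{μ′_j} − x_{ν′_j} with all indices in {k−n, …, k} that are nonzero and σ-safely linearly independent, with A_k v = F′(x_k) v on the corresponding orthogonal complement. Then ‖A_{k+1} − A_k‖ ≤ (3L√n/σ) ∑_{i=k−n}^{k} ‖x_{i+1} − x_i‖. -/
open Matrix

lemma path_pt {E : Type*} [NormedAddCommGroup E] [NormedSpace ℝ E] (D : Set E) (hD : Convex ℝ D)
    (z : ℕ → E) (m : ℕ) (hz : ∀ i ≤ m, z i ∈ D) (s : ℝ)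
    (hs : s ≤ ∑ i ∈ Finset.range m, ‖z (i+1) - z i‖) :
    ∃ y ∈ D, ∀ i ≤ m, ‖z i - y‖ ≤ |∑ j ∈ Finset.range i, ‖z (j+1) - z j‖ - s| := by
  induction m with
  | zero =>
    refine ⟨z 0, hz 0 le_rfl, fun i hi => ?_⟩
    obtain rfl : i = 0 := by omega
    simp
  | succ m ih =>
    by_cases h : s ≤ ∑ i ∈ Finset.range m, ‖z (i+1) - z i‖
    · obtain ⟨y, hy, H⟩ := ih (fun i hi => hz i (by omega)) h
      refine ⟨y, hy, fun i hi => ?_⟩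
      rcases Nat.lt_or_ge m i with h1 | h1
      · obtain rfl : i = m + 1 := by omega
        have h2 := H m le_rfl
        rw [abs_of_nonneg (by linarith)] at h2
        rw [Finset.sum_range_succ]
        refine le_trans ?_ (le_abs_self _)
        have := norm_sub_le_norm_sub_add_norm_sub (z (m+1)) (z m) y
        linarith
      · exact H i h1
    · push Not at h
      rw [Finset.sum_range_succ] at hs
      set d := ‖z (m+1) - z m‖ with hd
      set S := ∑ i ∈ Finset.range m, ‖z (i+1) - z i‖ with hS
      have hdpos : 0 < d := by linarith
      have key : ∀ i ≤ m, ‖z i - z m‖ ≤ S - ∑ j ∈ Finset.range i, ‖z (j+1) - z j‖ := by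
        intro i hi
        have h1 := dist_le_Ico_sum_dist z hi
        rw [Finset.sum_Ico_eq_sub _ hi] at h1
        simp only [dist_eq_norm] at h1
        have h2 : ∀ i, ∑ j ∈ Finset.range i, ‖z j - z (j+1)‖ = ∑ j ∈ Finset.range i, ‖z (j+1) - z j‖ :=
          fun i => Finset.sum_congr rfl fun j _ => norm_sub_rev _ _
        rw [h2, h2] at h1
        exact h1
      have ht0 : 0 ≤ (s - S) / d := div_nonneg (by linarith) hdpos.le
      have ht1 : (s - S) / d ≤ 1 := by rw [div_le_one hdpos]; linarith
      have htd : (s - S) / d * d = s - S := by field_simp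
      refine ⟨z m + ((s - S) / d) • (z (m+1) - z m),
        hD.add_smul_sub_mem (hz m (by omega)) (hz _ le_rfl) ⟨ht0, ht1⟩, fun i hi => ?_⟩
      rcases Nat.lt_or_ge m i with h1 | h1
      · obtain rfl : i = m + 1 := by omega
        rw [Finset.sum_range_succ]
        have : z (m+1) - (z m + ((s - S) / d) • (z (m+1) - z m)) = (1 - (s-S)/d) • (z (m+1) - z m) := by
          module
        rw [this, norm_smul, Real.norm_of_nonneg (by linarith), ← hd]
        refine le_trans ?_ (le_abs_self _)
        rw [sub_mul, htd]; linarith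
      · have : z i - (z m + ((s - S) / d) • (z (m+1) - z m)) =
          (z i - z m) - ((s-S)/d) • (z (m+1) - z m) := by abel
        rw [this]
        refine le_trans (norm_sub_le _ _) ?_
        rw [norm_smul, Real.norm_of_nonneg ht0, ← hd, htd, abs_sub_comm]
        refine le_trans ?_ (le_abs_self _)
        linarith [key i h1]

lemma mv {E : Type*} [NormedAddCommGroup E] [NormedSpace ℝ E] (D : Set E) (hD : Convex ℝ D)
    (F : E → E) (hF : ContDiff ℝ 1 F) (L : ℝ) (hL : 0 ≤ L)
    (hLip : ∀ x ∈ D, ∀ y ∈ D, ‖fderiv ℝ F x - fderiv ℝ F y‖ ≤ L * ‖x - y‖)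
    (y : E) (hy : y ∈ D) (R : ℝ) (a b : E) (ha : a ∈ D) (hb : b ∈ D)
    (ha' : ‖a - y‖ ≤ R) (hb' : ‖b - y‖ ≤ R) :
    ‖F a - F b - fderiv ℝ F y (a - b)‖ ≤ L * R * ‖a - b‖ := by
  refine (hD.inter (convex_closedBall y R)).norm_image_sub_le_of_norm_fderiv_le' (𝕜 := ℝ)
    (fun x _ => (hF.differentiable (by norm_num)) x) (fun x hx => ?_) ⟨hb, by simpa [dist_eq_norm]⟩
    ⟨ha, by simpa [dist_eq_norm]⟩
  refine (hLip x hx.1 y hy).trans ?_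
  gcongr
  simpa [dist_eq_norm] using hx.2

lemma eig_bound {ℓ : ℕ} (l : Fin ℓ → ℝ) (h0 : ∀ i, 0 ≤ l i) (hs : ∑ i, l i = ℓ) (i : Fin ℓ) :
    ∏ j, l j ≤ 4 * l i := by
  rw [← Finset.mul_prod_erase _ _ (Finset.mem_univ i), mul_comm]
  refine mul_le_mul_of_nonneg_right ?_ (h0 i)
  calc ∏ j ∈ Finset.univ.erase i, l j ≤ ∏ j ∈ Finset.univ.erase i, Real.exp (l j - 1) := by
        refine Finset.prod_le_prod (fun j _ => h0 j) fun j _ => ?_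
        linarith [Real.add_one_le_exp (l j - 1)]
    _ = Real.exp (∑ j ∈ Finset.univ.erase i, (l j - 1)) := (Real.exp_sum _ _).symm
    _ ≤ Real.exp 1 := by
        apply Real.exp_le_exp.2
        have := Finset.add_sum_erase Finset.univ (fun j => l j - 1) (Finset.mem_univ i)
        simp [Finset.sum_sub_distrib, hs] at this
        have := h0 i
        simp only [Finset.sum_sub_distrib] at *
        simp at *
        linarith
    _ ≤ 4 := by linarith [Real.exp_one_lt_d9]

lemma quad_bound {ℓ : ℕ} (G : Matrix (Fin ℓ) (Fin ℓ) ℝ) (hG : G.PosSemidef) (htr : G.trace = ℓ)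
    (c : Fin ℓ → ℝ) : G.det * (c ⬝ᵥ c) ≤ 4 * (c ⬝ᵥ (G *ᵥ c)) := by
  have hH := hG.isHermitian
  have hdet : G.det = ∏ i, hH.eigenvalues i := by simpa using hH.det_eq_prod_eigenvalues
  have hev : ∀ i, G.det ≤ 4 * hH.eigenvalues i := by
    intro i
    rw [hdet]
    refine eig_bound _ hG.eigenvalues_nonneg ?_ i
    have := hH.trace_eq_sum_eigenvalues
    rw [htr] at this
    simpa using this.symm
  set b := hH.eigenvectorBasis
  let w : EuclideanSpace ℝ (Fin ℓ) := WithLp.toLp 2 c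
  let g : EuclideanSpace ℝ (Fin ℓ) := WithLp.toLp 2 (G *ᵥ c)
  have hinner : ∀ p q : EuclideanSpace ℝ (Fin ℓ), inner ℝ p q = p.ofLp ⬝ᵥ q.ofLp := by
    intro p q
    simp [EuclideanSpace.inner_eq_star_dotProduct, dotProduct_comm]
  have hbg : ∀ i, inner ℝ (b i) g = hH.eigenvalues i * inner ℝ (b i) w := by
    intro i
    have hGt : Gᵀ = G := by rw [← conjTranspose_eq_transpose_of_trivial]; exact hH
    rw [hinner, hinner, dotProduct_mulVec, ← mulVec_transpose, hGt, hH.mulVec_eigenvectorBasis,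
      smul_dotProduct, smul_eq_mul]
  have e1 : c ⬝ᵥ c = ∑ i, (inner ℝ (b i) w) ^ 2 := by
    have := b.sum_inner_mul_inner w w
    rw [hinner w w] at this
    rw [show c ⬝ᵥ c = w.ofLp ⬝ᵥ w.ofLp from rfl, ← this]
    exact Finset.sum_congr rfl fun i _ => by rw [real_inner_comm (b i) w]; ring
  have e2 : c ⬝ᵥ (G *ᵥ c) = ∑ i, hH.eigenvalues i * (inner ℝ (b i) w) ^ 2 := by
    have := b.sum_inner_mul_inner w g
    rw [hinner w g] at this
    rw [show c ⬝ᵥ (G *ᵥ c) = w.ofLp ⬝ᵥ g.ofLp from rfl, ← this]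
    exact Finset.sum_congr rfl fun i _ => by rw [hbg, real_inner_comm (b i) w]; ring
  rw [e1, e2, Finset.mul_sum, Finset.mul_sum]
  refine Finset.sum_le_sum fun i _ => ?_
  rw [← mul_assoc]
  exact mul_le_mul_of_nonneg_right (hev i) (sq_nonneg _)

lemma coef_bound {n ℓ : ℕ} (σ : ℝ) (hσ : 0 < σ) (v : Fin ℓ → EuclideanSpace ℝ (Fin n))
    (h : safelyLinIndep σ v) (c : Fin ℓ → ℝ) :
    σ ^ 2 * ∑ j, c j ^ 2 ≤ 4 * ‖∑ j, c j • (‖v j‖⁻¹ • v j)‖ ^ 2 := by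
  obtain ⟨h0, h1⟩ := h
  set V : Matrix (Fin n) (Fin ℓ) ℝ := Matrix.of fun i (j : Fin ℓ) => v j i / ‖v j‖ with hV
  have hps : (Vᵀ * V).PosSemidef := by
    simpa using Matrix.posSemidef_conjTranspose_mul_self V
  have htr : (Vᵀ * V).trace = ℓ := by
    have : ∀ j, (Vᵀ * V) j j = 1 := by
      intro j
      have hp : ‖v j‖ ≠ 0 := norm_ne_zero_iff.2 (h0 j)
      have h2 := EuclideanSpace.real_norm_sq_eq (v j)
      simp only [Matrix.mul_apply, Matrix.transpose_apply, hV, Matrix.of_apply]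
      rw [show ∑ x, v j x / ‖v j‖ * (v j x / ‖v j‖) = (∑ x, v j x ^ 2) / ‖v j‖ ^ 2 by
        rw [Finset.sum_div]; exact Finset.sum_congr rfl fun x _ => by ring]
      rw [← h2]; field_simp
    simp [Matrix.trace, this]
  have hq := quad_bound _ hps htr c
  have e1 : c ⬝ᵥ c = ∑ j, c j ^ 2 := Finset.sum_congr rfl fun j _ => by ring
  have e2 : c ⬝ᵥ ((Vᵀ * V) *ᵥ c) = ‖∑ j, c j • (‖v j‖⁻¹ • v j)‖ ^ 2 := by
    rw [← Matrix.mulVec_mulVec, dotProduct_mulVec, Matrix.vecMul_transpose,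
      EuclideanSpace.real_norm_sq_eq]
    refine Finset.sum_congr rfl fun i _ => ?_
    have : (∑ j, c j • (‖v j‖⁻¹ • v j)) i = (V *ᵥ c) i := by
      simp [Matrix.mulVec, dotProduct, hV]
      exact Finset.sum_congr rfl fun x _ => by ring
    rw [this]; ring
  rw [e1, e2] at hq
  refine le_trans ?_ hq
  exact mul_le_mul_of_nonneg_right h1 (Finset.sum_nonneg fun _ _ => sq_nonneg _)

lemma op_bound {n ℓ : ℕ} (hℓn : ℓ ≤ n) (σ : ℝ) (hσ : 0 < σ) (v : Fin ℓ → EuclideanSpace ℝ (Fin n))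
    (h : safelyLinIndep σ v) (T : EuclideanSpace ℝ (Fin n) →L[ℝ] EuclideanSpace ℝ (Fin n))
    (M : ℝ) (hM : 0 ≤ M) (h1 : ∀ j, ‖T (v j)‖ ≤ M * ‖v j‖)
    (h2 : ∀ w, (∀ j, inner ℝ (v j) w = (0:ℝ)) → ‖T w‖ ≤ M * ‖w‖) :
    ‖T‖ ≤ M * (2 * Real.sqrt n / σ + 1) := by
  refine T.opNorm_le_bound (by positivity) fun u => ?_
  set K := Submodule.span ℝ (Set.range v)
  obtain ⟨p, hp, q, hq, rfl⟩ := K.exists_add_mem_mem_orthogonal u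
  obtain ⟨a, ha⟩ := (Submodule.mem_span_range_iff_exists_fun ℝ).1 hp
  have hpq : inner ℝ p q = (0:ℝ) := hq p hp
  have hn := norm_add_sq_eq_norm_sq_add_norm_sq_of_inner_eq_zero p q hpq
  have hpn : ‖p‖ ≤ ‖p + q‖ := by
    by_contra! hc; nlinarith [norm_nonneg q, norm_nonneg p, norm_nonneg (p+q)]
  have hqn : ‖q‖ ≤ ‖p + q‖ := by
    by_contra! hc; nlinarith [norm_nonneg q, norm_nonneg p, norm_nonneg (p+q)]
  have hv0 : ∀ j, ‖v j‖ ≠ 0 := fun j => norm_ne_zero_iff.2 (h.1 j)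
  have hp2 : ∑ j, (a j * ‖v j‖) • (‖v j‖⁻¹ • v j) = p := by
    rw [← ha]
    refine Finset.sum_congr rfl fun j _ => ?_
    rw [smul_smul, mul_assoc, mul_inv_cancel₀ (hv0 j), mul_one]
  have hc := coef_bound σ hσ v h (fun j => a j * ‖v j‖)
  rw [hp2] at hc
  have hcs : (∑ j, |a j * ‖v j‖|) ^ 2 ≤ n * ∑ j, (a j * ‖v j‖) ^ 2 := by
    have := sq_sum_le_card_mul_sum_sq (s := Finset.univ) (f := fun j => |a j * ‖v j‖|)
    simp only [sq_abs, Finset.card_univ, Fintype.card_fin] at this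
    refine this.trans ?_
    have : (ℓ : ℝ) ≤ n := by exact_mod_cast hℓn
    exact mul_le_mul_of_nonneg_right this (Finset.sum_nonneg fun _ _ => sq_nonneg _)
  have hsum : ∑ j, |a j * ‖v j‖| ≤ 2 * Real.sqrt n / σ * ‖p‖ := by
    refine abs_le_of_sq_le_sq' ?_ (by positivity) |>.2
    refine hcs.trans ?_
    rw [mul_pow, div_pow, mul_pow, Real.sq_sqrt (by positivity), div_mul_eq_mul_div,
      le_div_iff₀ (by positivity)]
    have : (0:ℝ) ≤ n := by positivity
    nlinarith
  have hTp : ‖T p‖ ≤ M * ∑ j, |a j * ‖v j‖| := by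
    rw [← ha, map_sum, Finset.mul_sum]
    refine norm_sum_le_of_le _ fun j _ => ?_
    rw [map_smul, norm_smul, abs_mul, abs_norm, Real.norm_eq_abs]
    nlinarith [h1 j, abs_nonneg (a j)]
  have hTq : ‖T q‖ ≤ M * ‖q‖ := h2 q fun j => hq _ (Submodule.subset_span ⟨j, rfl⟩)
  rw [map_add]
  calc ‖T p + T q‖ ≤ ‖T p‖ + ‖T q‖ := norm_add_le _ _
    _ ≤ M * (2 * Real.sqrt n / σ * ‖p + q‖) + M * ‖p + q‖ := by
        refine add_le_add (hTp.trans ?_) (hTq.trans ?_)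
        · refine mul_le_mul_of_nonneg_left (hsum.trans ?_) hM
          exact mul_le_mul_of_nonneg_left hpn (by positivity)
        · exact mul_le_mul_of_nonneg_left hqn hM
    _ = _ := by ring

lemma half_bound {n : ℕ} (D : Set (EuclideanSpace ℝ (Fin n))) (hD : Convex ℝ D)
    (F : EuclideanSpace ℝ (Fin n) → EuclideanSpace ℝ (Fin n)) (hF : ContDiff ℝ 1 F)
    (L : ℝ) (hL : 0 ≤ L)
    (hLip : ∀ x ∈ D, ∀ y ∈ D, ‖fderiv ℝ F x - fderiv ℝ F y‖ ≤ L * ‖x - y‖)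
    (σ : ℝ) (hσ : 0 < σ) (y : EuclideanSpace ℝ (Fin n)) (hy : y ∈ D) (R : ℝ) (hR : 0 ≤ R)
    (ℓ : ℕ) (hℓn : ℓ ≤ n) (a b : Fin ℓ → EuclideanSpace ℝ (Fin n)) (x : EuclideanSpace ℝ (Fin n))
    (ha : ∀ j, a j ∈ D ∧ ‖a j - y‖ ≤ R) (hb : ∀ j, b j ∈ D ∧ ‖b j - y‖ ≤ R)
    (hx : x ∈ D ∧ ‖x - y‖ ≤ R)
    (hs : safelyLinIndep σ (fun j => a j - b j)) (A : Matrix (Fin n) (Fin n) ℝ)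
    (hA1 : ∀ j, Matrix.toEuclideanLin A (a j - b j) = F (a j) - F (b j))
    (hA2 : ∀ v : EuclideanSpace ℝ (Fin n), (∀ j, inner ℝ (a j - b j) v = (0 : ℝ)) →
      Matrix.toEuclideanLin A v = fderiv ℝ F x v) :
    ‖Matrix.toEuclideanCLM (𝕜 := ℝ) A - fderiv ℝ F y‖ ≤ L * R * (2 * Real.sqrt n / σ + 1) := by
  have hEq : ∀ v, Matrix.toEuclideanCLM (𝕜 := ℝ) A v = Matrix.toEuclideanLin A v := fun v => rfl
  refine op_bound hℓn σ hσ _ hs _ (L * R) (by positivity) (fun j => ?_) (fun w hw => ?_)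
  · rw [ContinuousLinearMap.sub_apply, hEq, hA1]
    exact mv D hD F hF L hL hLip y hy R _ _ (ha j).1 (hb j).1 (ha j).2 (hb j).2
  · rw [ContinuousLinearMap.sub_apply, hEq, hA2 w hw, ← ContinuousLinearMap.sub_apply]
    refine (ContinuousLinearMap.le_opNorm _ _).trans ?_
    refine mul_le_mul_of_nonneg_right ((hLip x hx.1 y hy).trans ?_) (norm_nonneg _)
    exact mul_le_mul_of_nonneg_left hx.2 hL

/-- **Lemma 4, bound (25).** If `A_{k+1}` and `A_k` are built (in the sense of (21)) from
`σ`-safely linearly independent difference vectors of the iterates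
`x_{k−n+1}, …, x_{k+1}` and `x_{k−n}, …, x_k` respectively, then
`‖A_{k+1} − A_k‖ ≤ (3L√n/σ) ∑_{i=k−n}^{k} ‖x_{i+1} − x_i‖`. -/
theorem stmt_7 {n : ℕ} (D : Set (EuclideanSpace ℝ (Fin n))) (hD : Convex ℝ D)
    (F : EuclideanSpace ℝ (Fin n) → EuclideanSpace ℝ (Fin n)) (hF : ContDiff ℝ 1 F)
    (L : ℝ)
    (hLip : ∀ x ∈ D, ∀ y ∈ D, ‖fderiv ℝ F x - fderiv ℝ F y‖ ≤ L * ‖x - y‖)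
    (σ : ℝ) (hσ : σ ∈ Set.Ioo (0 : ℝ) 1)
    (k : ℕ) (hk : n ≤ k)
    (x : ℕ → EuclideanSpace ℝ (Fin n))
    (hxD : ∀ i ∈ Finset.Icc (k - n) (k + 1), x i ∈ D)
    -- the matrix `A_{k+1}`
    (ℓ : ℕ) (hℓ : 0 < ℓ) (hℓn : ℓ ≤ n)
    (μ ν : Fin ℓ → ℕ)
    (hμ : ∀ j, μ j ∈ Finset.Icc (k - n + 1) (k + 1))
    (hν : ∀ j, ν j ∈ Finset.Icc (k - n + 1) (k + 1))
    (hsli : safelyLinIndep σ (fun j => x (μ j) - x (ν j)))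
    (A' : Matrix (Fin n) (Fin n) ℝ)
    (hA'1 : ∀ j, Matrix.toEuclideanLin A' (x (μ j) - x (ν j)) = F (x (μ j)) - F (x (ν j)))
    (hA'2 : ∀ v : EuclideanSpace ℝ (Fin n),
      (∀ j, inner ℝ (x (μ j) - x (ν j)) v = (0 : ℝ)) →
      Matrix.toEuclideanLin A' v = fderiv ℝ F (x (k + 1)) v)
    -- the matrix `A_k`
    (ℓ' : ℕ) (hℓ' : 0 < ℓ') (hℓ'n : ℓ' ≤ n)
    (μ' ν' : Fin ℓ' → ℕ)
    (hμ' : ∀ j, μ' j ∈ Finset.Icc (k - n) k)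
    (hν' : ∀ j, ν' j ∈ Finset.Icc (k - n) k)
    (hsli' : safelyLinIndep σ (fun j => x (μ' j) - x (ν' j)))
    (A : Matrix (Fin n) (Fin n) ℝ)
    (hA1 : ∀ j, Matrix.toEuclideanLin A (x (μ' j) - x (ν' j)) = F (x (μ' j)) - F (x (ν' j)))
    (hA2 : ∀ v : EuclideanSpace ℝ (Fin n),
      (∀ j, inner ℝ (x (μ' j) - x (ν' j)) v = (0 : ℝ)) →
      Matrix.toEuclideanLin A v = fderiv ℝ F (x k) v) :
    ‖Matrix.toEuclideanCLM (𝕜 := ℝ) A' - Matrix.toEuclideanCLM (𝕜 := ℝ) A‖ ≤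
      3 * L * Real.sqrt n / σ * ∑ i ∈ Finset.Icc (k - n) k, ‖x (i + 1) - x i‖ := by
  obtain ⟨hσ0, hσ1⟩ := hσ
  set S := ∑ i ∈ Finset.Icc (k - n) k, ‖x (i + 1) - x i‖ with hS
  have hS' : S = ∑ i ∈ Finset.range (n + 1), ‖x (k - n + (i + 1)) - x (k - n + i)‖ := by
    rw [hS, ← Finset.Ico_add_one_right_eq_Icc, Finset.sum_Ico_eq_sum_range]
    rw [show k + 1 - (k - n) = n + 1 by omega]
    rfl
  have hS0 : 0 ≤ S := Finset.sum_nonneg fun _ _ => norm_nonneg _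
  -- `L` is nonnegative since `D` contains two distinct points
  have hL : 0 ≤ L := by
    have hne := hsli.1 ⟨0, hℓ⟩
    have h1 := hμ ⟨0, hℓ⟩
    have h2 := hν ⟨0, hℓ⟩
    simp only [Finset.mem_Icc] at h1 h2 hxD
    have h3 := (norm_nonneg _).trans (hLip _ (hxD _ ⟨by omega, h1.2⟩) _ (hxD _ ⟨by omega, h2.2⟩))
    exact nonneg_of_mul_nonneg_left h3 (norm_pos_iff.2 hne)
  -- the midpoint of the polygonal path
  obtain ⟨y, hy, hyd⟩ := path_pt D hD (fun i => x (k - n + i)) (n + 1)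
    (fun i hi => hxD _ (by rw [Finset.mem_Icc]; omega)) (S / 2) (by rw [← hS']; linarith)
  have hpt : ∀ i ∈ Finset.Icc (k - n) (k + 1), x i ∈ D ∧ ‖x i - y‖ ≤ S / 2 := by
    intro i hi
    refine ⟨hxD i hi, ?_⟩
    rw [Finset.mem_Icc] at hi
    have h1 := hyd (i - (k - n)) (by omega)
    simp only [show k - n + (i - (k - n)) = i by omega] at h1
    refine h1.trans ?_
    have h2 : 0 ≤ ∑ j ∈ Finset.range (i - (k - n)), ‖x (k - n + (j + 1)) - x (k - n + j)‖ :=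
      Finset.sum_nonneg fun _ _ => norm_nonneg _
    have h3 : ∑ j ∈ Finset.range (i - (k - n)), ‖x (k - n + (j + 1)) - x (k - n + j)‖ ≤ S := by
      rw [hS']
      refine Finset.sum_le_sum_of_subset_of_nonneg ?_ fun _ _ _ => norm_nonneg _
      exact Finset.range_subset_range.2 (by omega)
    rw [abs_le]; constructor <;> linarith
  simp only [Finset.mem_Icc] at hpt hμ hν hμ' hν'
  have B' := half_bound D hD F hF L hL hLip σ hσ0 y hy (S / 2) (by linarith) ℓ hℓn
    (fun j => x (μ j)) (fun j => x (ν j)) (x (k + 1))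
    (fun j => hpt _ (by have := hμ j; omega)) (fun j => hpt _ (by have := hν j; omega))
    (hpt _ (by omega)) hsli A' hA'1 hA'2
  have B := half_bound D hD F hF L hL hLip σ hσ0 y hy (S / 2) (by linarith) ℓ' hℓ'n
    (fun j => x (μ' j)) (fun j => x (ν' j)) (x k)
    (fun j => hpt _ (by have := hμ' j; omega)) (fun j => hpt _ (by have := hν' j; omega))
    (hpt _ (by omega)) hsli' A hA1 hA2
  have htri := norm_sub_le_norm_sub_add_norm_sub (Matrix.toEuclideanCLM (𝕜 := ℝ) A')
    (fderiv ℝ F y) (Matrix.toEuclideanCLM (𝕜 := ℝ) A)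
  rw [norm_sub_rev (fderiv ℝ F y)] at htri
  have hr : 1 ≤ Real.sqrt n / σ := by
    rw [le_div_iff₀ hσ0, one_mul]
    refine hσ1.le.trans (Real.one_le_sqrt.2 ?_)
    exact_mod_cast (by omega : 1 ≤ n)
  have hLS : 0 ≤ L * S := mul_nonneg hL hS0
  calc _ ≤ L * S * (2 * (Real.sqrt n / σ) + 1) := by
        refine htri.trans ((add_le_add B' B).trans (le_of_eq ?_)); ring
    _ ≤ L * S * (3 * (Real.sqrt n / σ)) := mul_le_mul_of_nonneg_left (by linarith) hLS
    _ = _ := by ring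
end
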